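/- arXiv:1710.07537 — 2 statements merged into one kernel-verified Lean document; each statement's English description precedes it below -/
import Mathlib

section
/- Let d, k ≥ 1 and let S₁, S₂ ⊂ I^d be closed cubes with nonempty interior. Suppose condition (C1) holds: det(Σ_{i=1}^k t_i Hφ_i(ν)) ≠ 0 for every ν ∈ S₁ ∪ S₂ and every t ∈ ℝ^k with |t| = 1. If there exist exponents p, q ∈ [1,∞] and a constant C such that ‖E₁f · E₂g‖_{L^q(ℝ^{d+k})} ≤ C ‖f‖_{L^p(ℝ^d)} ‖g‖_{L^p(ℝ^d)} for all f, g, then q ≥ (d+k)/d. -/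
open MeasureTheory ENNReal Matrix

noncomputable section

/-- The extension (adjoint restriction) operator associated to the surface
`ξ ↦ (ξ, Φ ξ)`, acting on functions supported in `S ⊆ I^d`, evaluated at
`w = (x, t) ∈ ℝ^d × ℝ^k`. -/
def extOp (d k : ℕ) (S : Set (Fin d → ℝ)) (Φ : (Fin d → ℝ) → Fin k → ℝ)
    (f : (Fin d → ℝ) → ℂ) (w : (Fin d → ℝ) × (Fin k → ℝ)) : ℂ :=
  ∫ ξ in S, Complex.exp (2 * Real.pi * Complex.I *
    (((∑ i, w.1 i * ξ i) + ∑ j, w.2 j * Φ ξ j : ℝ) : ℂ)) * f ξ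

/-- `S` is a closed cube in `ℝ^d` (an axis-parallel cube `∏ [aᵢ - r, aᵢ + r]`). -/
def IsClosedCube (d : ℕ) (S : Set (Fin d → ℝ)) : Prop :=
  ∃ (a : Fin d → ℝ) (r : ℝ), 0 ≤ r ∧ S = {x | ∀ i, |x i - a i| ≤ r}

/-- The gradient `∇φ(ν)` of a scalar function on `ℝ^d`, as a vector. -/
def gradPhi (d : ℕ) (φ : (Fin d → ℝ) → ℝ) (ν : Fin d → ℝ) : Fin d → ℝ :=
  fun i => fderiv ℝ φ ν (Pi.single i 1)

/-- The Hessian matrix `Hφ(ν)` of a scalar function on `ℝ^d`. -/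
def hessPhi (d : ℕ) (φ : (Fin d → ℝ) → ℝ) (ν : Fin d → ℝ) : Matrix (Fin d) (Fin d) ℝ :=
  Matrix.of fun i j => fderiv ℝ (fun x => fderiv ℝ φ x (Pi.single j 1)) ν (Pi.single i 1)

/-- The `k × d` matrix `D(ν₁, ν₂)` whose `j`-th row is `∇φⱼ(ν₂) - ∇φⱼ(ν₁)`. -/
def Dmat (d k : ℕ) (Φ : (Fin d → ℝ) → Fin k → ℝ) (ν₁ ν₂ : Fin d → ℝ) :
    Matrix (Fin k) (Fin d) ℝ :=
  Matrix.of fun j i => gradPhi d (fun x => Φ x j) ν₂ i - gradPhi d (fun x => Φ x j) ν₁ i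

/-- The matrix `∑ᵢ tᵢ Hφᵢ(ν)`. -/
def tHess (d k : ℕ) (Φ : (Fin d → ℝ) → Fin k → ℝ) (t : Fin k → ℝ) (ν : Fin d → ℝ) :
    Matrix (Fin d) (Fin d) ℝ :=
  ∑ i, t i • hessPhi d (fun x => Φ x i) ν

/-- The `(k+d) × (k+d)` block matrix `M(t, ν₁, ν₂, ν)` with blocks
`0, D(ν₁,ν₂); D(ν₁,ν₂)ᵗ, ∑ᵢ tᵢ Hφᵢ(ν)`. -/
def Mmat (d k : ℕ) (Φ : (Fin d → ℝ) → Fin k → ℝ) (t : Fin k → ℝ) (ν₁ ν₂ ν : Fin d → ℝ) :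
    Matrix (Fin k ⊕ Fin d) (Fin k ⊕ Fin d) ℝ :=
  Matrix.fromBlocks 0 (Dmat d k Φ ν₁ ν₂) (Dmat d k Φ ν₁ ν₂)ᵀ (tHess d k Φ t ν)

theorem exists_taylor_bound {d k : ℕ} {Φ : (Fin d → ℝ) → Fin k → ℝ}
    (hΦ : ContDiff ℝ (⊤ : ℕ∞) Φ) :
    ∃ B : ℝ, 0 < B ∧ ∀ ξ ∈ Set.Icc (-1 : Fin d → ℝ) 1, ∀ η ∈ Set.Icc (-1 : Fin d → ℝ) 1,
      ‖Φ ξ - Φ η - fderiv ℝ Φ η (ξ - η)‖ ≤ B * ‖ξ - η‖ ^ 2 := by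
  have h1 : ContDiff ℝ 1 (fderiv ℝ Φ) := hΦ.fderiv_right (by norm_cast)
  obtain ⟨K, hK⟩ := h1.contDiffOn.exists_lipschitzOnWith one_ne_zero
    (convex_Icc (-1 : Fin d → ℝ) 1) isCompact_Icc
  refine ⟨K + 1, by positivity, fun ξ hξ η hη => ?_⟩
  have hseg : segment ℝ η ξ ⊆ Set.Icc (-1 : Fin d → ℝ) 1 :=
    (convex_Icc (-1 : Fin d → ℝ) 1).segment_subset hη hξ
  have h := Convex.norm_image_sub_le_of_norm_fderiv_le' (𝕜 := ℝ) (f := Φ) (s := segment ℝ η ξ)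
    (φ := fderiv ℝ Φ η) (C := K * ‖ξ - η‖) (x := η) (y := ξ)
    (fun z _ => (hΦ.differentiable (by simp)) z)
    (fun z hz => (hK.norm_sub_le (hseg hz) hη).trans
      (by gcongr; exact norm_sub_le_of_mem_segment hz))
    (convex_segment η ξ) (left_mem_segment ℝ η ξ) (right_mem_segment ℝ η ξ)
  nlinarith [sq_nonneg ‖ξ - η‖]

/-- The `i`-th partial derivative in `ξ` of the phase `τ · Φ(ξ)`. -/
def phaseGrad (d k : ℕ) (Φ : (Fin d → ℝ) → Fin k → ℝ) (z : (Fin d → ℝ) × (Fin k → ℝ)) :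
    Fin d → ℝ :=
  fun i => ∑ j, z.2 j * fderiv ℝ (fun x => Φ x j) z.1 (Pi.single i 1)

theorem contDiff_partial {d k : ℕ} {Φ : (Fin d → ℝ) → Fin k → ℝ}
    (hΦ : ContDiff ℝ (⊤ : ℕ∞) Φ) (j : Fin k) (e : Fin d → ℝ) :
    ContDiff ℝ 1 fun x => fderiv ℝ (fun x => Φ x j) x e := by
  have h : ContDiff ℝ (⊤ : ℕ∞) fun x => Φ x j := contDiff_pi.1 hΦ j
  have h1 : ContDiff ℝ 1 (fderiv ℝ fun x => Φ x j) := h.fderiv_right (by norm_cast)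
  exact h1.clm_apply contDiff_const

theorem contDiff_phaseGrad {d k : ℕ} {Φ : (Fin d → ℝ) → Fin k → ℝ}
    (hΦ : ContDiff ℝ (⊤ : ℕ∞) Φ) : ContDiff ℝ 1 (phaseGrad d k Φ) := by
  refine contDiff_pi.2 fun i => ContDiff.sum fun j _ => ?_
  refine ContDiff.mul ?_ ((contDiff_partial hΦ j _).comp contDiff_fst)
  exact (contDiff_pi.1 contDiff_id j).comp contDiff_snd

theorem fderiv_phaseGrad_left {d k : ℕ} {Φ : (Fin d → ℝ) → Fin k → ℝ}
    (hΦ : ContDiff ℝ (⊤ : ℕ∞) Φ) (ν : Fin d → ℝ) (t : Fin k → ℝ) (h : Fin d → ℝ) :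
    fderiv ℝ (phaseGrad d k Φ) (ν, t) (h, 0) = h ᵥ* tHess d k Φ t ν := by
  have hd : DifferentiableAt ℝ (phaseGrad d k Φ) (ν, t) :=
    (contDiff_phaseGrad hΦ).differentiable one_ne_zero _
  have h1 : HasFDerivAt (fun ξ => phaseGrad d k Φ (ξ, t))
      ((fderiv ℝ (phaseGrad d k Φ) (ν, t)).comp (.inl ℝ _ _)) ν :=
    HasFDerivAt.comp (f := fun ξ => (ξ, t)) (g := phaseGrad d k Φ) ν hd.hasFDerivAt
      (hasFDerivAt_prodMk_left ν t)
  have h2 : HasFDerivAt (fun ξ => phaseGrad d k Φ (ξ, t))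
      (ContinuousLinearMap.pi fun i => ∑ j, t j •
        fderiv ℝ (fun x => fderiv ℝ (fun x => Φ x j) x (Pi.single i 1)) ν) ν := by
    refine hasFDerivAt_pi.2 fun i => HasFDerivAt.fun_sum fun j _ => ?_
    exact (((contDiff_partial hΦ j _).differentiable one_ne_zero ν).hasFDerivAt).const_mul (t j)
  have h3 := DFunLike.congr_fun (h1.unique h2) h
  simp only [ContinuousLinearMap.comp_apply, ContinuousLinearMap.inl_apply] at h3
  rw [h3]
  ext i
  simp only [ContinuousLinearMap.pi_apply, _root_.sum_apply,
    _root_.smul_apply, smul_eq_mul, Matrix.vecMul, dotProduct, tHess,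
    Matrix.sum_apply, Matrix.smul_apply, hessPhi, Matrix.of_apply, Finset.mul_sum]
  rw [Finset.sum_comm]
  refine Finset.sum_congr rfl fun j _ => ?_
  conv_lhs => rw [pi_eq_sum_univ' h]
  simp only [map_sum, map_smul, smul_eq_mul, Finset.mul_sum]
  refine Finset.sum_congr rfl fun l _ => ?_
  ring

/-- If the Hessian of `t · Φ` at `ν` is invertible, then every covector near the gradient of
`t · Φ` at `ν` is a gradient of `τ · Φ` at some point near `ν`, for all `τ` near `t`. -/
theorem exists_phaseGrad_eq {d k : ℕ} {Φ : (Fin d → ℝ) → Fin k → ℝ}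
    (hΦ : ContDiff ℝ (⊤ : ℕ∞) Φ) {S : Set (Fin d → ℝ)} {ν : Fin d → ℝ} (hν : ν ∈ interior S)
    {t : Fin k → ℝ} (ht : (tHess d k Φ t ν).det ≠ 0) :
    ∃ c : ℝ, 0 < c ∧ ∃ ρ : ℝ, 0 < ρ ∧ ∀ y τ, ‖y - phaseGrad d k Φ (ν, t)‖ ≤ c → ‖τ - t‖ ≤ c →
      ∃ ξ, Metric.ball ξ ρ ⊆ S ∧ phaseGrad d k Φ (ξ, τ) = y := by
  obtain ⟨ρ, hρ, hball⟩ := Metric.isOpen_iff.1 isOpen_interior ν hν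
  have hF : HasStrictFDerivAt (phaseGrad d k Φ) (fderiv ℝ (phaseGrad d k Φ) (ν, t)) (ν, t) :=
    (contDiff_phaseGrad hΦ).contDiffAt.hasStrictFDerivAt one_ne_zero
  have hG := hF.prodMk (hasStrictFDerivAt_snd (𝕜 := ℝ) (p := (ν, t)))
  have hsurj : ((fderiv ℝ (phaseGrad d k Φ) (ν, t)).prod
      (ContinuousLinearMap.snd ℝ (Fin d → ℝ) (Fin k → ℝ))).range = ⊤ := by
    refine LinearMap.range_eq_top.2 fun ⟨y, s⟩ => ?_
    have hu : IsUnit (tHess d k Φ t ν) := (Matrix.isUnit_iff_isUnit_det _).2 ht.isUnit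
    obtain ⟨h, hh⟩ := Matrix.vecMul_surjective_iff_isUnit.2 hu
      (y - fderiv ℝ (phaseGrad d k Φ) (ν, t) (0, s))
    refine ⟨(h, s), Prod.ext ?_ rfl⟩
    have e : ((h, s) : (Fin d → ℝ) × (Fin k → ℝ)) = (h, 0) + (0, s) := by simp
    change fderiv ℝ (phaseGrad d k Φ) (ν, t) (h, s) = y
    rw [e, map_add, fderiv_phaseGrad_left hΦ]
    simp only at hh
    rw [hh]; simp
  have hmap := hG.map_nhds_eq_of_surj hsurj
  have hU : Metric.ball ν (ρ / 2) ×ˢ (Set.univ : Set (Fin k → ℝ)) ∈ nhds (ν, t) :=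
    prod_mem_nhds (Metric.ball_mem_nhds _ (by positivity)) Filter.univ_mem
  have himg := Filter.image_mem_map (m := fun z : (Fin d → ℝ) × (Fin k → ℝ) =>
    (phaseGrad d k Φ z, z.2)) hU
  rw [hmap] at himg
  obtain ⟨c, hc, hcb⟩ := Metric.nhds_basis_closedBall.mem_iff.1 himg
  refine ⟨c, hc, ρ / 2, by positivity, fun y τ hy hτ => ?_⟩
  have hmem : (y, τ) ∈ Metric.closedBall (phaseGrad d k Φ (ν, t), t) c := by
    rw [Metric.mem_closedBall, Prod.dist_eq, dist_eq_norm, dist_eq_norm]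
    exact max_le hy hτ
  obtain ⟨⟨ξ, τ'⟩, ⟨hξ, -⟩, heq⟩ := hcb hmem
  obtain ⟨h1, h2⟩ := Prod.ext_iff.1 heq
  simp only at h1 h2
  subst h2
  refine ⟨ξ, fun z hz => interior_subset (hball ?_), h1⟩
  rw [Metric.mem_ball] at *
  linarith [dist_triangle z ξ ν, (hξ : dist ξ ν < ρ / 2)]

theorem half_measureReal_le_norm_integral_exp {d : ℕ} {A : Set (Fin d → ℝ)}
    (hA : MeasurableSet A) (hAf : volume A ≠ ⊤) {ψ : (Fin d → ℝ) → ℝ} (hψ : Continuous ψ)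
    (c : ℝ) (hc : ∀ ξ ∈ A, |2 * Real.pi * (ψ ξ - c)| ≤ 1) :
    volume.real A / 2 ≤ ‖∫ ξ in A, Complex.exp (2 * Real.pi * Complex.I * (ψ ξ : ℂ))‖ := by
  have hfin : IsFiniteMeasure (volume.restrict A) := ⟨by simpa using hAf.lt_top⟩
  have h1 : ‖∫ ξ in A, Complex.exp (2 * Real.pi * Complex.I * (ψ ξ : ℂ))‖ =
      ‖∫ ξ in A, Complex.exp ((2 * Real.pi * (ψ ξ - c) : ℝ) * Complex.I)‖ := by
    have : ∀ ξ, Complex.exp (2 * Real.pi * Complex.I * (ψ ξ : ℂ)) =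
        Complex.exp ((2 * Real.pi * c : ℝ) * Complex.I) *
          Complex.exp ((2 * Real.pi * (ψ ξ - c) : ℝ) * Complex.I) := by
      intro ξ
      rw [← Complex.exp_add]
      congr 1
      push_cast
      ring
    simp_rw [this]
    rw [integral_const_mul, norm_mul, Complex.norm_exp_ofReal_mul_I, one_mul]
  have hint : Integrable (fun ξ => Complex.exp ((2 * Real.pi * (ψ ξ - c) : ℝ) * Complex.I))
      (volume.restrict A) := by
    refine Integrable.of_bound (C := 1) (Continuous.aestronglyMeasurable (by fun_prop)) ?_
    exact Filter.Eventually.of_forall fun ξ => (Complex.norm_exp_ofReal_mul_I _).le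
  rw [h1]
  refine le_trans ?_ (Complex.re_le_norm _)
  have h2 := integral_re hint
  simp only [RCLike.re_to_complex, Complex.exp_ofReal_mul_I_re] at h2
  rw [← h2]
  have hintc : Integrable (fun ξ => Real.cos (2 * Real.pi * (ψ ξ - c))) (volume.restrict A) := by
    simpa only [RCLike.re_to_complex, Complex.exp_ofReal_mul_I_re] using hint.re
  calc volume.real A / 2 = ∫ ξ in A, (1 / 2 : ℝ) := by simp [div_eq_mul_inv]
    _ ≤ _ := by
      refine setIntegral_mono_on (integrable_const _) hintc hA fun ξ hξ => ?_
      have := Real.one_sub_sq_div_two_le_cos (x := 2 * Real.pi * (ψ ξ - c))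
      have h3 := (sq_le_one_iff_abs_le_one _).2 (hc ξ hξ)
      linarith

/-- The index of the cell of the grid of side `1 / n` that contains `ξ`. -/
def cell (d n : ℕ) (ξ : Fin d → ℝ) : Fin d → ℤ := fun i => ⌊(n : ℝ) * ξ i⌋

theorem measurable_cell (d n : ℕ) : Measurable (cell d n) :=
  measurable_pi_iff.2 fun i => Int.measurable_floor.comp ((measurable_pi_apply i).const_mul _)

theorem measurableSet_cell_preimage (d n : ℕ) (m : Fin d → ℤ) :
    MeasurableSet (cell d n ⁻¹' {m}) :=
  measurable_cell d n (measurableSet_singleton m)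

theorem volume_cell_preimage {d n : ℕ} (hn : 0 < n) (m : Fin d → ℤ) :
    volume (cell d n ⁻¹' {m}) = ENNReal.ofReal (((n : ℝ) ^ d)⁻¹) := by
  have hn' : (0 : ℝ) < n := by exact_mod_cast hn
  have : cell d n ⁻¹' {m} =
      Set.univ.pi fun i => Set.Ico ((m i : ℝ) / n) (((m i : ℝ) + 1) / n) := by
    ext ξ
    simp only [Set.mem_preimage, Set.mem_singleton_iff, funext_iff, cell, Int.floor_eq_iff,
      Set.mem_pi, Set.mem_univ, true_imp_iff, Set.mem_Ico, div_le_iff₀ hn', lt_div_iff₀ hn',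
      mul_comm (n : ℝ)]
  rw [this, Real.volume_pi_Ico, ← ENNReal.ofReal_prod_of_nonneg]
  · congr 1
    rw [Finset.prod_congr rfl (g := fun _ => (n : ℝ)⁻¹) (fun i _ => by field_simp; ring)]
    simp
  · intro i _
    rw [← sub_div]
    simp [hn'.le]

theorem norm_sub_le_of_cell_eq {d n : ℕ} (hn : 0 < n) {ξ η : Fin d → ℝ}
    (h : cell d n ξ = cell d n η) : ‖ξ - η‖ ≤ 1 / n := by
  have hn' : (0 : ℝ) < n := by exact_mod_cast hn
  refine (pi_norm_le_iff_of_nonneg (by positivity)).2 fun i => ?_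
  have h1 := (Int.abs_sub_lt_one_of_floor_eq_floor (congrFun h i)).le
  rw [← mul_sub, abs_mul, abs_of_pos hn'] at h1
  rw [le_div_iff₀ hn', mul_comm]
  simpa using h1

theorem cell_mem_Icc {d n : ℕ} {ξ : Fin d → ℝ} (h : ξ ∈ Set.Icc (-1 : Fin d → ℝ) 1) :
    cell d n ξ ∈ Finset.Icc (fun _ => -(n : ℤ) : Fin d → ℤ) (fun _ => (n : ℤ)) := by
  have hn : (0 : ℝ) ≤ n := n.cast_nonneg
  rw [Finset.mem_Icc]
  refine ⟨fun i => Int.le_floor.2 ?_, fun i => Int.floor_le_iff.2 ?_⟩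
  · have := h.1 i
    simp only [Pi.neg_apply, Pi.one_apply] at this
    push_cast
    nlinarith
  · have := h.2 i
    simp only [Pi.one_apply] at this
    push_cast
    nlinarith

/-- The character with frequency `v`, cut off to `S`, with sign `+1` on the grid cells whose index
lies in `s` and sign `-1` on the other cells. -/
def signedChar (d n : ℕ) (S : Set (Fin d → ℝ)) (v : Fin d → ℝ) (s : Finset (Fin d → ℤ)) :
    (Fin d → ℝ) → ℂ :=
  S.indicator fun ξ => Complex.exp (2 * Real.pi * Complex.I * ((∑ i, v i * ξ i : ℝ) : ℂ)) *
    if cell d n ξ ∈ s then 1 else -1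

theorem norm_exp_two_pi_I_mul (x : ℝ) :
    ‖Complex.exp (2 * Real.pi * Complex.I * (x : ℂ))‖ = 1 := by
  rw [← Complex.norm_exp_ofReal_mul_I (2 * Real.pi * x)]
  congr 2
  push_cast
  ring

theorem measurable_signedChar {d n : ℕ} {S : Set (Fin d → ℝ)} (hS : MeasurableSet S)
    (v : Fin d → ℝ) (s : Finset (Fin d → ℤ)) : Measurable (signedChar d n S v s) := by
  refine Measurable.indicator (Measurable.mul (Continuous.measurable (by fun_prop)) ?_) hS
  exact Measurable.ite (measurable_cell d n s.measurableSet) measurable_const measurable_const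

theorem norm_signedChar_le {d n : ℕ} {S : Set (Fin d → ℝ)} (v : Fin d → ℝ)
    (s : Finset (Fin d → ℤ)) (ξ : Fin d → ℝ) : ‖signedChar d n S v s ξ‖ ≤ 1 := by
  refine (norm_indicator_le_norm_self _ _).trans ?_
  rw [norm_mul, norm_exp_two_pi_I_mul]
  split_ifs <;> simp

theorem eLpNorm_signedChar_le {d n : ℕ} {S : Set (Fin d → ℝ)} (hS : MeasurableSet S)
    (v : Fin d → ℝ) (s : Finset (Fin d → ℤ)) (p : ℝ≥0∞) :
    eLpNorm (signedChar d n S v s) p volume ≤ volume S ^ p.toReal⁻¹ := by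
  have h : signedChar d n S v s = S.indicator (signedChar d n S v s) := by
    simp [signedChar, Set.indicator_indicator]
  rw [h, eLpNorm_indicator_eq_eLpNorm_restrict hS]
  refine (eLpNorm_le_of_ae_bound (C := 1)
    (Filter.Eventually.of_forall (norm_signedChar_le v s))).trans ?_
  simp

theorem integrable_exp_mul_signedChar {d k n : ℕ} {Φ : (Fin d → ℝ) → Fin k → ℝ}
    (hΦ : Continuous Φ) {S : Set (Fin d → ℝ)} (hS : MeasurableSet S) (hSf : volume S ≠ ⊤)
    (v : Fin d → ℝ) (s : Finset (Fin d → ℤ)) (w : (Fin d → ℝ) × (Fin k → ℝ)) :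
    Integrable (fun ξ => Complex.exp (2 * Real.pi * Complex.I *
      (((∑ i, w.1 i * ξ i) + ∑ j, w.2 j * Φ ξ j : ℝ) : ℂ)) * signedChar d n S v s ξ)
      (volume.restrict S) := by
  have hfin : IsFiniteMeasure (volume.restrict S) := ⟨by simpa using hSf.lt_top⟩
  refine Integrable.of_bound (C := 1) ((Measurable.mul (Continuous.measurable (by fun_prop))
    (measurable_signedChar hS v s)).aestronglyMeasurable) (Filter.Eventually.of_forall fun ξ => ?_)
  rw [norm_mul, norm_exp_two_pi_I_mul, one_mul]
  exact norm_signedChar_le v s ξ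

theorem continuous_extOp_signedChar {d k n : ℕ} {Φ : (Fin d → ℝ) → Fin k → ℝ}
    (hΦ : Continuous Φ) {S : Set (Fin d → ℝ)} (hS : MeasurableSet S) (hSf : volume S ≠ ⊤)
    (v : Fin d → ℝ) (s : Finset (Fin d → ℤ)) :
    Continuous (extOp d k S Φ (signedChar d n S v s)) := by
  have hfin : IsFiniteMeasure (volume.restrict S) := ⟨by simpa using hSf.lt_top⟩
  refine continuous_of_dominated (bound := fun _ => 1)
    (fun w => (integrable_exp_mul_signedChar hΦ hS hSf v s w).aestronglyMeasurable)
    (fun w => Filter.Eventually.of_forall fun ξ => ?_) (integrable_const _)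
    (Filter.Eventually.of_forall fun ξ => by fun_prop)
  rw [norm_mul, norm_exp_two_pi_I_mul, one_mul]
  exact norm_signedChar_le v s ξ

theorem extOp_signedChar_insert_sub {d k n : ℕ} {Φ : (Fin d → ℝ) → Fin k → ℝ}
    (hΦ : Continuous Φ) {S : Set (Fin d → ℝ)} (hS : MeasurableSet S) (hSf : volume S ≠ ⊤)
    (v : Fin d → ℝ) {s : Finset (Fin d → ℤ)} {m : Fin d → ℤ} (hm : m ∉ s)
    (hmS : cell d n ⁻¹' {m} ⊆ S) (w : (Fin d → ℝ) × (Fin k → ℝ)) :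
    extOp d k S Φ (signedChar d n S v (insert m s)) w - extOp d k S Φ (signedChar d n S v s) w =
      2 * ∫ ξ in cell d n ⁻¹' {m}, Complex.exp (2 * Real.pi * Complex.I *
        (((∑ i, (w.1 + v) i * ξ i) + ∑ j, w.2 j * Φ ξ j : ℝ) : ℂ)) := by
  have hA := measurableSet_cell_preimage d n m
  unfold extOp
  rw [← integral_sub (integrable_exp_mul_signedChar hΦ hS hSf v _ w)
    (integrable_exp_mul_signedChar hΦ hS hSf v _ w), ← integral_const_mul,
    ← Set.inter_eq_self_of_subset_right hmS, ← setIntegral_indicator hA]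
  refine setIntegral_congr_fun hS fun ξ hξ => ?_
  simp only [signedChar, Set.indicator_of_mem hξ, Finset.mem_insert]
  by_cases h : cell d n ξ = m
  · have h' : cell d n ξ ∉ s := h ▸ hm
    have hmem : ξ ∈ cell d n ⁻¹' {m} := h
    rw [Set.indicator_of_mem hmem]
    simp only [h, true_or, if_true, hm, if_false]
    have e : Complex.exp (2 * Real.pi * Complex.I *
        (((∑ i, (w.1 + v) i * ξ i) + ∑ j, w.2 j * Φ ξ j : ℝ) : ℂ)) =
        Complex.exp (2 * Real.pi * Complex.I *
          (((∑ i, w.1 i * ξ i) + ∑ j, w.2 j * Φ ξ j : ℝ) : ℂ)) *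
        Complex.exp (2 * Real.pi * Complex.I * ((∑ i, v i * ξ i : ℝ) : ℂ)) := by
      rw [← Complex.exp_add]
      congr 1
      simp only [Pi.add_apply, add_mul, Finset.sum_add_distrib]
      push_cast
      ring
    rw [e]
    ring
  · have hmem : ξ ∉ cell d n ⁻¹' {m} := h
    rw [Set.indicator_of_notMem hmem]
    simp [h]

theorem card_powerset_mul_le_sum_norm_extOp {d k n : ℕ} {Φ : (Fin d → ℝ) → Fin k → ℝ}
    (hΦ : Continuous Φ) {S : Set (Fin d → ℝ)} (hS : MeasurableSet S) (hSf : volume S ≠ ⊤)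
    (v : Fin d → ℝ) {M : Finset (Fin d → ℤ)} {m : Fin d → ℤ} (hm : m ∈ M)
    (hmS : cell d n ⁻¹' {m} ⊆ S) (w : (Fin d → ℝ) × (Fin k → ℝ)) :
    (2 : ℝ) ^ M.card * ‖∫ ξ in cell d n ⁻¹' {m}, Complex.exp (2 * Real.pi * Complex.I *
        (((∑ i, (w.1 + v) i * ξ i) + ∑ j, w.2 j * Φ ξ j : ℝ) : ℂ))‖ ≤
      ∑ s ∈ M.powerset, ‖extOp d k S Φ (signedChar d n S v s) w‖ := by
  obtain ⟨M', hm', rfl⟩ : ∃ M', m ∉ M' ∧ insert m M' = M :=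
    ⟨M.erase m, Finset.notMem_erase m M, Finset.insert_erase hm⟩
  rw [Finset.sum_powerset_insert hm', ← Finset.sum_add_distrib,
    Finset.card_insert_of_notMem hm', pow_succ, mul_assoc]
  have hcard : (2 : ℝ) ^ M'.card = (M'.powerset.card : ℝ) := by simp
  rw [hcard, ← nsmul_eq_mul]
  refine Finset.card_nsmul_le_sum _ _ _ fun s hs => ?_
  have h := extOp_signedChar_insert_sub hΦ hS hSf v
    (fun h => hm' (Finset.mem_powerset.1 hs h)) hmS w
  have h2 := congrArg norm h
  rw [norm_mul, Complex.norm_ofNat] at h2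
  rw [← h2, add_comm]
  exact norm_sub_le _ _

/-- On a grid cell containing a critical point of the phase, the oscillatory integral has no
cancellation. -/
theorem le_norm_cell_integral {d k n : ℕ} (hn : 0 < n) {Φ : (Fin d → ℝ) → Fin k → ℝ}
    (hΦ : ContDiff ℝ (⊤ : ℕ∞) Φ) {B T : ℝ} (hB : 0 < B)
    (hTaylor : ∀ ξ ∈ Set.Icc (-1 : Fin d → ℝ) 1, ∀ η ∈ Set.Icc (-1 : Fin d → ℝ) 1,
      ‖Φ ξ - Φ η - fderiv ℝ Φ η (ξ - η)‖ ≤ B * ‖ξ - η‖ ^ 2)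
    {x : Fin d → ℝ} {t : Fin k → ℝ} (ht : ‖t‖ ≤ T) (hT : 2 * Real.pi * (k * T * B) ≤ n ^ 2)
    {η : Fin d → ℝ} (hcell : cell d n ⁻¹' {cell d n η} ⊆ Set.Icc (-1 : Fin d → ℝ) 1)
    (hcrit : phaseGrad d k Φ (η, t) = -x) :
    ((n : ℝ) ^ d)⁻¹ / 2 ≤ ‖∫ ξ in cell d n ⁻¹' {cell d n η}, Complex.exp
      (2 * Real.pi * Complex.I * (((∑ i, x i * ξ i) + ∑ j, t j * Φ ξ j : ℝ) : ℂ))‖ := by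
  have hn' : (0 : ℝ) < n := by exact_mod_cast hn
  have hΦc := hΦ.continuous
  have hvol := volume_cell_preimage hn (cell d n η)
  have key := half_measureReal_le_norm_integral_exp (measurableSet_cell_preimage d n (cell d n η))
    (by rw [hvol]; exact ENNReal.ofReal_ne_top)
    (ψ := fun ξ => (∑ i, x i * ξ i) + ∑ j, t j * Φ ξ j) (by fun_prop)
    ((∑ i, x i * η i) + ∑ j, t j * Φ η j) ?_
  · rwa [measureReal_def, hvol, ENNReal.toReal_ofReal (by positivity)] at key
  intro ξ hξ
  have hη : η ∈ cell d n ⁻¹' {cell d n η} := rfl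
  have hlin : ∑ j, t j * fderiv ℝ Φ η (ξ - η) j = -∑ i, x i * (ξ i - η i) := by
    have hj : ∀ j, fderiv ℝ Φ η (ξ - η) j =
        ∑ i, (ξ i - η i) * fderiv ℝ (fun x => Φ x j) η (Pi.single i 1) := by
      intro j
      have hd : DifferentiableAt ℝ Φ η := hΦ.differentiable (by simp) η
      have h1 : fderiv ℝ (fun x => Φ x j) η = (ContinuousLinearMap.proj j).comp (fderiv ℝ Φ η) :=
        ((hasFDerivAt_pi'.1 hd.hasFDerivAt) j).fderiv
      have h2 : fderiv ℝ Φ η (ξ - η) j = fderiv ℝ (fun x => Φ x j) η (ξ - η) := by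
        rw [h1]; rfl
      rw [h2]
      conv_lhs => rw [pi_eq_sum_univ' (ξ - η)]
      simp [map_sum, map_smul]
    have hx : ∀ i, x i = -∑ j, t j * fderiv ℝ (fun x => Φ x j) η (Pi.single i 1) := by
      intro i
      have := congrFun hcrit i
      simp only [phaseGrad, Pi.neg_apply] at this
      linarith
    simp_rw [hj, hx, Finset.mul_sum, neg_mul, Finset.sum_neg_distrib, neg_neg, Finset.sum_mul]
    rw [Finset.sum_comm]
    exact Finset.sum_congr rfl fun i _ => Finset.sum_congr rfl fun j _ => by ring
  have hrem : ((∑ i, x i * ξ i) + ∑ j, t j * Φ ξ j) - ((∑ i, x i * η i) + ∑ j, t j * Φ η j) =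
      ∑ j, t j * (Φ ξ - Φ η - fderiv ℝ Φ η (ξ - η)) j := by
    simp only [Pi.sub_apply, mul_sub, Finset.sum_sub_distrib] at hlin ⊢
    linarith
  have hT0 : 0 ≤ T := (norm_nonneg t).trans ht
  have hbound : |∑ j, t j * (Φ ξ - Φ η - fderiv ℝ Φ η (ξ - η)) j| ≤
      k * (T * (B * (1 / n) ^ 2)) := by
    refine (Finset.abs_sum_le_sum_abs _ _).trans ?_
    refine (Finset.sum_le_card_nsmul _ _ (T * (B * (1 / n) ^ 2)) fun j _ => ?_).trans (by simp)
    rw [abs_mul]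
    refine mul_le_mul ((norm_le_pi_norm t j).trans ht) ?_ (abs_nonneg _) hT0
    refine (norm_le_pi_norm (Φ ξ - Φ η - fderiv ℝ Φ η (ξ - η)) j).trans
      ((hTaylor ξ (hcell hξ) η (hcell hη)).trans ?_)
    gcongr
    exact norm_sub_le_of_cell_eq hn hξ
  rw [hrem, abs_mul, abs_of_pos (by positivity : 0 < 2 * Real.pi)]
  calc _ ≤ 2 * Real.pi * (k * (T * (B * (1 / n) ^ 2))) := by gcongr
    _ = 2 * Real.pi * (k * T * B) / n ^ 2 := by field_simp
    _ ≤ 1 := (div_le_one (by positivity)).2 hT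

/-- The indices of the grid cells of side `1 / n` that meet `[-1, 1]^d`. -/
def cellIndices (d n : ℕ) : Finset (Fin d → ℤ) :=
  Finset.Icc (fun _ => -(n : ℤ)) (fun _ => (n : ℤ))

theorem exists_sum_norm_extOp_lower_bound {d k : ℕ} {Φ : (Fin d → ℝ) → Fin k → ℝ}
    (hΦ : ContDiff ℝ (⊤ : ℕ∞) Φ) {S : Set (Fin d → ℝ)} (hS : MeasurableSet S)
    (hSI : S ⊆ Set.Icc (-1) 1) (hSi : (interior S).Nonempty) {t₀ : Fin k → ℝ} (ht₀ : ‖t₀‖ ≤ 1)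
    (hdet : ∀ ν ∈ S, (tHess d k Φ t₀ ν).det ≠ 0) {B κ : ℝ} (hB : 0 < B) (hκ : 0 < κ)
    (hTaylor : ∀ ξ ∈ Set.Icc (-1 : Fin d → ℝ) 1, ∀ η ∈ Set.Icc (-1 : Fin d → ℝ) 1,
      ‖Φ ξ - Φ η - fderiv ℝ Φ η (ξ - η)‖ ≤ B * ‖ξ - η‖ ^ 2)
    (hκB : 2 * Real.pi * (k * (2 * κ) * B) ≤ 1) :
    ∃ a : ℝ, 0 < a ∧ ∃ (n₀ : ℕ) (v : ℕ → Fin d → ℝ), ∀ n : ℕ, n₀ ≤ n → 0 < n →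
      ∀ w : (Fin d → ℝ) × (Fin k → ℝ), ‖w.1‖ ≤ a * n ^ 2 → ‖w.2 - (κ * n ^ 2) • t₀‖ ≤ a * n ^ 2 →
        (2 : ℝ) ^ (cellIndices d n).card * (((n : ℝ) ^ d)⁻¹ / 2) ≤
          ∑ s ∈ (cellIndices d n).powerset, ‖extOp d k S Φ (signedChar d n S (v n) s) w‖ := by
  obtain ⟨ν, hν⟩ := hSi
  obtain ⟨c, hc, ρ, hρ, hsolve⟩ := exists_phaseGrad_eq hΦ hν (hdet ν (interior_subset hν))
  set g := phaseGrad d k Φ (ν, t₀)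
  obtain ⟨n₀, hn₀⟩ := exists_nat_gt ρ⁻¹
  refine ⟨κ * min c 1, by positivity, n₀, fun n => -((κ * n ^ 2) • g), ?_⟩
  rintro n hn₀n hn ⟨x, t⟩ hx ht
  simp only at hx ht
  have hn' : (0 : ℝ) < n := by exact_mod_cast hn
  set R : ℝ := κ * n ^ 2 with hR
  have hRpos : 0 < R := by positivity
  have hxR : ‖x‖ ≤ R * min c 1 := by linarith [hx]
  have htR : ‖t - R • t₀‖ ≤ R * min c 1 := by linarith [ht]
  obtain ⟨η, hηball, hη⟩ := hsolve (g - R⁻¹ • x) (R⁻¹ • t)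
    (by
      rw [sub_sub_cancel_left, norm_neg, norm_smul, Real.norm_of_nonneg (by positivity),
        inv_mul_le_iff₀ hRpos]
      exact hxR.trans (by gcongr; exact min_le_left _ _))
    (by
      have : R⁻¹ • t - t₀ = R⁻¹ • (t - R • t₀) := by
        rw [smul_sub, inv_smul_smul₀ hRpos.ne']
      rw [this, norm_smul, Real.norm_of_nonneg (by positivity), inv_mul_le_iff₀ hRpos]
      exact htR.trans (by gcongr; exact min_le_left _ _))
  have hcrit : phaseGrad d k Φ (η, t) = -(x + -(R • g)) := by
    have h1 : phaseGrad d k Φ (η, t) = R • phaseGrad d k Φ (η, R⁻¹ • t) := by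
      ext i
      simp only [phaseGrad, Pi.smul_apply, smul_eq_mul, Finset.mul_sum]
      exact Finset.sum_congr rfl fun j _ => by field_simp
    rw [h1, hη, smul_sub, smul_inv_smul₀ hRpos.ne']
    abel
  have htn : ‖t‖ ≤ 2 * R := by
    calc ‖t‖ = ‖(t - R • t₀) + R • t₀‖ := by simp
      _ ≤ ‖t - R • t₀‖ + ‖R • t₀‖ := norm_add_le _ _
      _ ≤ R * 1 + R * 1 := by
        rw [norm_smul, Real.norm_of_nonneg hRpos.le]
        gcongr
        exact htR.trans (by gcongr; exact min_le_right _ _)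
      _ = 2 * R := by ring
  have hcellS : cell d n ⁻¹' {cell d n η} ⊆ S := by
    intro ξ hξ
    refine hηball ?_
    rw [Metric.mem_ball, dist_eq_norm]
    refine (norm_sub_le_of_cell_eq hn hξ).trans_lt ?_
    have : (n₀ : ℝ) ≤ n := by exact_mod_cast hn₀n
    rw [one_div]
    exact inv_lt_of_inv_lt₀ hρ (by linarith)
  have hηS : η ∈ S := hηball (Metric.mem_ball_self hρ)
  have hSf : volume S ≠ ⊤ := ((measure_mono hSI).trans_lt isCompact_Icc.measure_lt_top).ne
  refine le_trans ?_ (card_powerset_mul_le_sum_norm_extOp hΦ.continuous hS hSf _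
    (cell_mem_Icc (hSI hηS)) hcellS (x, t))
  refine mul_le_mul_of_nonneg_left ?_ (by positivity)
  refine le_norm_cell_integral hn hΦ hB hTaylor htn ?_ (hcellS.trans hSI) hcrit
  calc 2 * Real.pi * (k * (2 * R) * B) = 2 * Real.pi * (k * (2 * κ) * B) * n ^ 2 := by
        rw [hR]; ring
    _ ≤ 1 * n ^ 2 := by gcongr
    _ = n ^ 2 := one_mul _

/-- A uniform `L^q` bound on the products of two finite families bounds the measure of any set on
which the averages of both families are bounded below. -/
theorem mul_volume_rpow_le_of_bilinear {W ι κ : Type*} [MeasureSpace W] {q : ℝ≥0∞} (hq : 1 ≤ q)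
    (hqtop : q ≠ ⊤) (P : Finset ι) (Q : Finset κ) (hP : P.Nonempty) (hQ : Q.Nonempty)
    {F : ι → W → ℂ} {G : κ → W → ℂ}
    (hF : ∀ s ∈ P, AEStronglyMeasurable (F s) volume)
    (hG : ∀ s ∈ Q, AEStronglyMeasurable (G s) volume) {K : ℝ≥0∞}
    (hK : ∀ s ∈ P, ∀ s' ∈ Q, eLpNorm (fun w => F s w * G s' w) q volume ≤ K)
    {D : Set W} (hD : MeasurableSet D) {b : ℝ} (hb : 0 ≤ b)
    (hFD : ∀ w ∈ D, P.card * b ≤ ∑ s ∈ P, ‖F s w‖)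
    (hGD : ∀ w ∈ D, Q.card * b ≤ ∑ s ∈ Q, ‖G s w‖) :
    ENNReal.ofReal (b ^ 2) * volume D ^ (1 / q.toReal) ≤ K := by
  have hPQ : 0 < (P.card * Q.card : ℝ) := by
    have := hP.card_pos
    have := hQ.card_pos
    positivity
  have hupper : eLpNorm (∑ z ∈ P ×ˢ Q, fun w => ‖F z.1 w * G z.2 w‖) q volume ≤
      (P.card * Q.card : ℕ) * K := by
    refine (eLpNorm_sum_le (fun z hz => ?_) hq).trans ?_
    · rw [Finset.mem_product] at hz
      exact ((hF _ hz.1).mul (hG _ hz.2)).norm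
    · refine (Finset.sum_le_card_nsmul _ _ K fun z hz => ?_).trans (by simp)
      rw [Finset.mem_product] at hz
      rw [eLpNorm_norm]
      exact hK _ hz.1 _ hz.2
  have hlower : eLpNorm (D.indicator fun _ => (P.card * Q.card : ℝ) * b ^ 2) q volume ≤
      eLpNorm (∑ z ∈ P ×ˢ Q, fun w => ‖F z.1 w * G z.2 w‖) q volume := by
    refine eLpNorm_mono_real fun w => ?_
    rw [Finset.sum_apply]
    by_cases hw : w ∈ D
    · rw [Set.indicator_of_mem hw, Real.norm_of_nonneg (by positivity)]
      simp only [norm_mul]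
      rw [Finset.sum_product]
      simp only
      rw [← Finset.sum_mul_sum]
      calc (P.card * Q.card : ℝ) * b ^ 2 = (P.card * b) * (Q.card * b) := by ring
        _ ≤ _ := mul_le_mul (hFD w hw) (hGD w hw) (by positivity)
          (Finset.sum_nonneg fun _ _ => norm_nonneg _)
    · rw [Set.indicator_of_notMem hw, norm_zero]
      exact Finset.sum_nonneg fun _ _ => norm_nonneg _
  rw [eLpNorm_indicator_const hD (by positivity) hqtop] at hlower
  have h := hlower.trans hupper
  rw [Real.enorm_eq_ofReal (by positivity), ENNReal.ofReal_mul hPQ.le, mul_assoc] at h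
  have hcast : ENNReal.ofReal (P.card * Q.card : ℝ) = (P.card * Q.card : ℕ) := by
    rw [← ENNReal.ofReal_natCast]
    push_cast
    rfl
  rw [hcast] at h
  have hne : ((P.card * Q.card : ℕ) : ℝ≥0∞) ≠ 0 := by
    exact_mod_cast (mul_pos hP.card_pos hQ.card_pos).ne'
  exact (ENNReal.mul_le_mul_iff_right hne (ENNReal.natCast_ne_top _)).1 h

theorem IsClosedCube.measurableSet {d : ℕ} {S : Set (Fin d → ℝ)} (h : IsClosedCube d S) :
    MeasurableSet S := by
  obtain ⟨a, r, -, rfl⟩ := h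
  rw [Set.ofPred_forall]
  exact (isClosed_iInter fun i => isClosed_le (by fun_prop) continuous_const).measurableSet

theorem le_of_forall_rpow_le {d k q L K : ℝ} (hd : 0 < d) (hq : 0 < q) (hL : 0 < L) {n₀ : ℕ}
    (h : ∀ n : ℕ, n₀ ≤ n → 0 < n → L * (n : ℝ) ^ (2 * ((d + k) / q - d)) ≤ K) :
    (d + k) / d ≤ q := by
  by_contra! hlt
  have hpos : 0 < 2 * ((d + k) / q - d) := by
    rw [lt_div_iff₀ hd] at hlt
    have : d < (d + k) / q := by rw [lt_div_iff₀ hq]; linarith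
    linarith
  have ht := ((tendsto_rpow_atTop hpos).comp tendsto_natCast_atTop_atTop).const_mul_atTop hL
  obtain ⟨n, h1, h2, h3⟩ := ((ht.eventually_gt_atTop K).and
    ((Filter.eventually_ge_atTop n₀).and (Filter.eventually_gt_atTop 0))).exists
  exact absurd (h n h2 h3) (not_le.2 h1)

/-- **Necessary condition (i): `q ≥ (d+k)/d`.** If the cubes have nonempty
interior, condition (C1) holds, and the bilinear estimate
`‖E₁f · E₂g‖_{L^q} ≤ C ‖f‖_{L^p} ‖g‖_{L^p}` holds for some exponents
`p, q ∈ [1, ∞]`, then `q ≥ (d+k)/d`. -/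
theorem necessary_condition_q
    (d k : ℕ) (hd : 1 ≤ d) (hk : 1 ≤ k)
    (Φ : (Fin d → ℝ) → Fin k → ℝ) (hΦ : ContDiff ℝ (⊤ : ℕ∞) Φ)
    (S₁ S₂ : Set (Fin d → ℝ))
    (hS₁ : IsClosedCube d S₁) (hS₂ : IsClosedCube d S₂)
    (hS₁i : (interior S₁).Nonempty) (hS₂i : (interior S₂).Nonempty)
    (hS₁I : S₁ ⊆ Set.Icc (-1) 1) (hS₂I : S₂ ⊆ Set.Icc (-1) 1)
    (hC1 : ∀ ν ∈ S₁ ∪ S₂, ∀ t : Fin k → ℝ, (∑ i, t i ^ 2) = 1 →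
      (tHess d k Φ t ν).det ≠ 0)
    (p q : ℝ≥0∞) (hp : 1 ≤ p) (hq : 1 ≤ q) (C : ℝ)
    (hbil : ∀ f g : (Fin d → ℝ) → ℂ,
      eLpNorm (fun w => extOp d k S₁ Φ f w * extOp d k S₂ Φ g w) q volume ≤
        ENNReal.ofReal C * eLpNorm f p volume * eLpNorm g p volume) :
    ENNReal.ofReal (((d : ℝ) + k) / d) ≤ q := by
  rcases eq_or_ne q ⊤ with rfl | hqtop
  · exact le_top
  have hq0 : 0 < q.toReal := ENNReal.toReal_pos (by positivity) hqtop
  have hd0 : (0 : ℝ) < d := by exact_mod_cast hd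
  have hk0 : (0 : ℝ) < k := by exact_mod_cast hk
  have hm₁ := hS₁.measurableSet
  have hm₂ := hS₂.measurableSet
  have hf₁ : volume S₁ ≠ ⊤ := ((measure_mono hS₁I).trans_lt isCompact_Icc.measure_lt_top).ne
  have hf₂ : volume S₂ ≠ ⊤ := ((measure_mono hS₂I).trans_lt isCompact_Icc.measure_lt_top).ne
  obtain ⟨B, hB, hTaylor⟩ := exists_taylor_bound hΦ
  set t₀ : Fin k → ℝ := Pi.single ⟨0, hk⟩ 1 with ht₀
  have ht₀n : ‖t₀‖ ≤ 1 := by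
    refine (pi_norm_le_iff_of_nonneg zero_le_one).2 fun j => ?_
    rw [ht₀, Pi.single_apply]
    split_ifs <;> simp
  have ht₀s : ∑ i, t₀ i ^ 2 = 1 := by
    simp [ht₀, Pi.single_apply]
  set κ : ℝ := (2 * Real.pi * (k * 2 * B))⁻¹ with hκ
  have hκ0 : 0 < κ := by positivity
  have hκB : 2 * Real.pi * (k * (2 * κ) * B) ≤ 1 := by
    rw [hκ]
    field_simp
    rfl
  obtain ⟨a₁, ha₁, n₁, v₁, h₁⟩ := exists_sum_norm_extOp_lower_bound hΦ hm₁ hS₁I hS₁i ht₀n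
    (fun ν hν => hC1 ν (Or.inl hν) t₀ ht₀s) hB hκ0 hTaylor hκB
  obtain ⟨a₂, ha₂, n₂, v₂, h₂⟩ := exists_sum_norm_extOp_lower_bound hΦ hm₂ hS₂I hS₂i ht₀n
    (fun ν hν => hC1 ν (Or.inr hν) t₀ ht₀s) hB hκ0 hTaylor hκB
  set a := min a₁ a₂ with ha
  have ha0 : 0 < a := lt_min ha₁ ha₂
  set K : ℝ≥0∞ := ENNReal.ofReal C * volume S₁ ^ p.toReal⁻¹ * volume S₂ ^ p.toReal⁻¹ with hK
  have hKtop : K ≠ ⊤ := by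
    have e₁ := ENNReal.rpow_ne_top_of_nonneg (inv_nonneg.2 (ENNReal.toReal_nonneg (a := p))) hf₁
    have e₂ := ENNReal.rpow_ne_top_of_nonneg (inv_nonneg.2 (ENNReal.toReal_nonneg (a := p))) hf₂
    exact ENNReal.mul_ne_top (ENNReal.mul_ne_top ENNReal.ofReal_ne_top e₁) e₂
  refine ENNReal.ofReal_le_of_le_toReal (le_of_forall_rpow_le (n₀ := max n₁ n₂) (K := K.toReal)
    (L := (1 / 4) * ((2 * a) ^ (d + k)) ^ (1 / q.toReal)) hd0 hq0 (by positivity)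
    fun n hn hn0 => ?_)
  have hn' : (0 : ℝ) < n := by exact_mod_cast hn0
  have hmain := mul_volume_rpow_le_of_bilinear (W := (Fin d → ℝ) × (Fin k → ℝ)) (K := K) hq hqtop
    (cellIndices d n).powerset (cellIndices d n).powerset
    (Finset.powerset_nonempty _) (Finset.powerset_nonempty _)
    (F := fun s => extOp d k S₁ Φ (signedChar d n S₁ (v₁ n) s))
    (G := fun s => extOp d k S₂ Φ (signedChar d n S₂ (v₂ n) s))
    (fun s _ => (continuous_extOp_signedChar hΦ.continuous hm₁ hf₁ _ s).aestronglyMeasurable)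
    (fun s _ => (continuous_extOp_signedChar hΦ.continuous hm₂ hf₂ _ s).aestronglyMeasurable)
    (fun s _ s' _ => (hbil _ _).trans (by
      rw [hK]
      gcongr
      · exact eLpNorm_signedChar_le hm₁ _ _ _
      · exact eLpNorm_signedChar_le hm₂ _ _ _))
    (D := Metric.closedBall 0 (a * n ^ 2) ×ˢ Metric.closedBall ((κ * n ^ 2) • t₀) (a * n ^ 2))
    (Metric.isClosed_closedBall.prod Metric.isClosed_closedBall).measurableSet
    (b := ((n : ℝ) ^ d)⁻¹ / 2) (by positivity) ?_ ?_
  · rw [Measure.volume_eq_prod, Measure.prod_prod, Real.volume_pi_closedBall _ (by positivity),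
      Real.volume_pi_closedBall _ (by positivity), ← ENNReal.ofReal_mul (by positivity),
      ENNReal.ofReal_rpow_of_nonneg (by positivity) (by positivity),
      ← ENNReal.ofReal_mul (by positivity), ENNReal.ofReal_le_iff_le_toReal hKtop] at hmain
    refine le_trans (le_of_eq ?_) hmain
    have e₁ : (2 * (a * (n : ℝ) ^ 2)) ^ Fintype.card (Fin d) *
        (2 * (a * (n : ℝ) ^ 2)) ^ Fintype.card (Fin k) =
        (2 * a) ^ (d + k) * (n : ℝ) ^ (2 * ((d : ℝ) + k)) := by
      have : (n : ℝ) ^ (2 * ((d : ℝ) + k)) = (n : ℝ) ^ (2 * (d + k)) := by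
        rw [← Real.rpow_natCast]
        push_cast
        rfl
      rw [this, Fintype.card_fin, Fintype.card_fin, ← pow_add, ← mul_assoc, mul_pow, ← pow_mul]
    have e₂ : (((n : ℝ) ^ d)⁻¹ / 2) ^ 2 = (1 / 4) * (n : ℝ) ^ (-(2 * (d : ℝ))) := by
      have : (n : ℝ) ^ (2 * (d : ℝ)) = ((n : ℝ) ^ d) ^ 2 := by
        rw [← pow_mul, ← Real.rpow_natCast]
        push_cast
        rw [mul_comm]
      rw [Real.rpow_neg hn'.le, this]
      ring
    rw [e₁, e₂, Real.mul_rpow (by positivity) (by positivity), ← Real.rpow_mul hn'.le]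
    have e₃ : (n : ℝ) ^ (2 * (((d : ℝ) + k) / q.toReal - d)) =
        (n : ℝ) ^ (-(2 * (d : ℝ))) * (n : ℝ) ^ (2 * ((d : ℝ) + k) * (1 / q.toReal)) := by
      rw [← Real.rpow_add hn']
      congr 1
      ring
    rw [e₃]
    ring
  · rintro w ⟨hw1, hw2⟩
    rw [mem_closedBall_zero_iff] at hw1
    rw [mem_closedBall_iff_norm] at hw2
    simpa using h₁ n (le_trans (le_max_left _ _) hn) hn0 w
      (hw1.trans (by gcongr; exact min_le_left _ _)) (hw2.trans (by gcongr; exact min_le_left _ _))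
  · rintro w ⟨hw1, hw2⟩
    rw [mem_closedBall_zero_iff] at hw1
    rw [mem_closedBall_iff_norm] at hw2
    simpa using h₂ n (le_trans (le_max_right _ _) hn) hn0 w
      (hw1.trans (by gcongr; exact min_le_right _ _))
      (hw2.trans (by gcongr; exact min_le_right _ _))

end
end

section
/- Let d, k ≥ 1 and let S₁, S₂ ⊂ I^d be closed cubes with nonempty interior. Suppose that for all ν₁ ∈ S₁ and ν₂ ∈ S₂ the matrix D(ν₁,ν₂) has rank k (equivalently, the vectors ∇φ_j(ν₂) − ∇φ_j(ν₁), j = 1,…,k, are linearly independent). If there exist exponents p, q ∈ [1,∞] and a constant C such that ‖E₁f · E₂g‖_{L^q(ℝ^{d+k})} ≤ C ‖f‖_{L^p(ℝ^d)} ‖g‖_{L^p(ℝ^d)} for all f, g, then 1/p + ((d+3k)/(d+k))·(1/(2q)) ≤ 1. -/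
open MeasureTheory ENNReal Matrix

noncomputable section

lemma exists_matrix_extending_rows {d k : ℕ} (D : Matrix (Fin k) (Fin d) ℝ)
    (hD : LinearIndependent ℝ (fun j => D j)) :
    ∃ (A : Matrix (Fin d) (Fin d) ℝ) (κ : Fin k → Fin d),
      IsUnit A.det ∧ Function.Injective κ ∧ ∀ j, A (κ j) = D j := by
  classical
  let b := Module.Basis.sumExtend hD
  have hb : ∀ j, b (Sum.inl j) = D j := fun j => by
    simp [b, Module.Basis.sumExtend]
    rfl
  have : Finite (Fin k ⊕ Module.Basis.sumExtendIndex hD) := Module.Finite.finite_basis b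
  have := Fintype.ofFinite (Fin k ⊕ Module.Basis.sumExtendIndex hD)
  have hc : Fintype.card (Fin k ⊕ Module.Basis.sumExtendIndex hD) = Fintype.card (Fin d) := by
    rw [← Module.finrank_eq_card_basis b]; simp
  let σ := Fintype.equivOfCardEq hc
  let b' := b.reindex σ
  refine ⟨Matrix.of b', fun j => σ (Sum.inl j), ?_, ?_, ?_⟩
  · rw [← Matrix.isUnit_iff_isUnit_det, ← Matrix.linearIndependent_rows_iff_isUnit]
    exact b'.linearIndependent
  · intro i j h
    simpa using h
  · intro j
    change b' (σ (Sum.inl j)) = D j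
    simp [b', hb]

lemma exists_quadratic_taylor_bound {d k : ℕ} {Φ : (Fin d → ℝ) → Fin k → ℝ}
    (hΦ : ContDiff ℝ (⊤ : ℕ∞) Φ) (ν : Fin d → ℝ) :
    ∃ K : ℝ, 0 ≤ K ∧ ∃ r > 0, ∀ η : Fin d → ℝ, ‖η‖ ≤ r → ∀ j,
      |Φ (ν + η) j - Φ ν j - ∑ i, gradPhi d (fun x => Φ x j) ν i * η i| ≤ K * ‖η‖ ^ 2 := by
  have hdiff : Differentiable ℝ Φ := hΦ.differentiable (by simp)
  have h1 : ContDiff ℝ 1 (fderiv ℝ Φ) :=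
    hΦ.fderiv_right (WithTop.coe_le_coe.2 (le_top : ((2 : ℕ) : ℕ∞) ≤ ⊤))
  obtain ⟨K, s, hs, hK⟩ := (h1.contDiffAt (x := ν)).exists_lipschitzOnWith
  obtain ⟨r, hr, hrs⟩ := Metric.nhds_basis_closedBall.mem_iff.1 hs
  refine ⟨K, K.2, r, hr, fun η hη j => ?_⟩
  have hsub : Metric.closedBall ν ‖η‖ ⊆ s := (Metric.closedBall_subset_closedBall hη).trans hrs
  have key := Convex.norm_image_sub_le_of_norm_fderiv_le' (f := Φ) (C := K * ‖η‖)
    (s := Metric.closedBall ν ‖η‖) (x := ν) (y := ν + η) (φ := fderiv ℝ Φ ν)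
    (fun x _ => hdiff x) (fun x hx => by
      refine (hK.norm_sub_le (hsub hx) (mem_of_mem_nhds hs)).trans ?_
      gcongr
      simpa [dist_eq_norm] using hx)
    (convex_closedBall _ _) (by simp) (by simp)
  have hgrad : ∑ i, gradPhi d (fun x => Φ x j) ν i * η i = fderiv ℝ Φ ν η j := by
    have h2 := congrArg (fun L => L η) (fderiv_apply (hdiff ν) j)
    change fderiv ℝ (fun x => Φ x j) ν η = fderiv ℝ Φ ν η j at h2
    rw [← h2]
    change _ = (fderiv ℝ (fun x => Φ x j) ν : (Fin d → ℝ) →ₗ[ℝ] ℝ) η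
    conv_rhs => rw [← Finset.univ_sum_single η]
    rw [map_sum]
    refine Finset.sum_congr rfl fun i _ => ?_
    have : (Pi.single i (η i) : Fin d → ℝ) = η i • Pi.single i 1 := by
      rw [← Pi.single_smul]; simp
    rw [this, map_smul, smul_eq_mul, mul_comm]
    rfl
  rw [hgrad]
  refine (norm_le_pi_norm (Φ (ν + η) - Φ ν - fderiv ℝ Φ ν η) j).trans ?_
  simpa [sq, mul_assoc] using key

/-- The phase of the oscillatory factor in `extOp`. -/
def extPhase {d k : ℕ} (Φ : (Fin d → ℝ) → Fin k → ℝ) (w : (Fin d → ℝ) × (Fin k → ℝ))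
    (ξ : Fin d → ℝ) : ℝ :=
  (∑ i, w.1 i * ξ i) + ∑ j, w.2 j * Φ ξ j

lemma half_volume_le_norm_extOp {d k : ℕ} {Φ : (Fin d → ℝ) → Fin k → ℝ} (hΦ : Continuous Φ)
    {S R : Set (Fin d → ℝ)} (hR : IsCompact R) (hRS : R ⊆ S)
    (ν : Fin d → ℝ) (w : (Fin d → ℝ) × (Fin k → ℝ))
    (hw : ∀ ξ ∈ R, |2 * Real.pi * (extPhase Φ w ξ - extPhase Φ w ν)| ≤ 1 / 2) :
    volume.real R / 2 ≤ ‖extOp d k S Φ (R.indicator fun _ => 1) w‖ := by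
  set E : (Fin d → ℝ) → ℂ := fun ξ => Complex.exp (2 * Real.pi * Complex.I * (extPhase Φ w ξ : ℂ))
    with hE
  have hEc : Continuous E := by
    unfold E extPhase
    fun_prop
  have hext : extOp d k S Φ (R.indicator fun _ => 1) w = ∫ ξ in R, E ξ := by
    have : ∀ ξ, Complex.exp (2 * Real.pi * Complex.I *
        (((∑ i, w.1 i * ξ i) + ∑ j, w.2 j * Φ ξ j : ℝ) : ℂ)) * R.indicator (fun _ => (1 : ℂ)) ξ
        = R.indicator E ξ := fun ξ => by
      by_cases h : ξ ∈ R <;> simp [h, hE, extPhase]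
    unfold extOp
    simp_rw [this]
    rw [setIntegral_indicator hR.measurableSet, Set.inter_eq_right.2 hRS]
  have hnorm : ∀ ξ, ‖E ξ‖ = 1 := fun ξ => by
    simp only [hE]
    rw [show 2 * Real.pi * Complex.I * (extPhase Φ w ξ : ℂ)
      = ((2 * Real.pi * extPhase Φ w ξ : ℝ) : ℂ) * Complex.I by push_cast; ring]
    exact Complex.norm_exp_ofReal_mul_I _
  have hdiff : ∀ ξ ∈ R, ‖E ξ - E ν‖ ≤ 1 / 2 := fun ξ hξ => by
    have : E ξ - E ν = E ν * (Complex.exp (Complex.I *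
        ((2 * Real.pi * (extPhase Φ w ξ - extPhase Φ w ν) : ℝ) : ℂ)) - 1) := by
      simp only [hE]
      rw [mul_sub, ← Complex.exp_add, mul_one]
      congr 2
      push_cast
      ring
    rw [this, norm_mul, hnorm, one_mul]
    exact Real.norm_exp_I_mul_ofReal_sub_one_le.trans (hw ξ hξ)
  have hint : ∫ ξ in R, (E ξ - E ν) = (∫ ξ in R, E ξ) - volume.real R • E ν := by
    rw [integral_sub (hEc.continuousOn.integrableOn_compact hR)
      (continuousOn_const.integrableOn_compact hR), setIntegral_const]
  have h1 := norm_setIntegral_le_of_norm_le_const (hR.measure_lt_top (μ := volume)) hdiff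
  rw [hint, norm_sub_rev] at h1
  have h2 := norm_sub_norm_le (volume.real R • E ν) (∫ ξ in R, E ξ)
  rw [norm_smul, hnorm, Real.norm_of_nonneg measureReal_nonneg] at h2
  rw [hext]
  linarith

/-- The anisotropic box `∏ₘ [-c δ ^ eₘ, c δ ^ eₘ]`. -/
def anisoBox {d : ℕ} (e : Fin d → ℕ) (c δ : ℝ) : Set (Fin d → ℝ) :=
  Set.Icc (fun m => -(c * δ ^ e m)) (fun m => c * δ ^ e m)

lemma mem_anisoBox {d : ℕ} {e : Fin d → ℕ} {c δ : ℝ} {y : Fin d → ℝ} :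
    y ∈ anisoBox e c δ ↔ ∀ m, |y m| ≤ c * δ ^ e m := by
  simp only [anisoBox, Set.mem_Icc, Pi.le_def, abs_le, forall_and]

lemma volume_anisoBox {d : ℕ} (e : Fin d → ℕ) {c δ : ℝ} (hc : 0 ≤ c) (hδ : 0 ≤ δ) :
    volume (anisoBox e c δ) = ENNReal.ofReal ((2 * c) ^ d * δ ^ ∑ m, e m) := by
  rw [anisoBox, Real.volume_Icc_pi, ← ENNReal.ofReal_prod_of_nonneg]
  · congr 1
    rw [← Finset.prod_pow_eq_pow_sum, ← Fin.prod_const d (2 * c), ← Finset.prod_mul_distrib]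
    exact Finset.prod_congr rfl fun m _ => by ring
  · intro m _
    have : 0 ≤ c * δ ^ e m := by positivity
    linarith

lemma exists_phase_bound {d k : ℕ} {Φ : (Fin d → ℝ) → Fin k → ℝ}
    (hΦ : ContDiff ℝ (⊤ : ℕ∞) Φ) {A : Matrix (Fin d) (Fin d) ℝ} (hA : IsUnit A.det)
    {e : Fin d → ℕ} (he : ∀ m, 1 ≤ e m) {ν : Fin d → ℝ} {S : Set (Fin d → ℝ)} (hS : S ∈ nhds ν) :
    ∃ ε₀ > 0, ∀ ε, 0 < ε → ε ≤ ε₀ → ∀ δ, 0 < δ → δ ≤ 1 → ∀ y ∈ anisoBox e ε δ,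
      ν + A⁻¹ *ᵥ y ∈ S ∧ ∀ (v : Fin d → ℝ) (w : (Fin d → ℝ) × (Fin k → ℝ)),
        (∀ m, |v m| ≤ 2 * δ⁻¹ ^ e m) → (∀ j, |w.2 j| ≤ δ⁻¹ ^ 2) →
        (∀ i, w.1 i + ∑ j, w.2 j * gradPhi d (fun x => Φ x j) ν i = (v ᵥ* A) i) →
        |2 * Real.pi * (extPhase Φ w (ν + A⁻¹ *ᵥ y) - extPhase Φ w ν)| ≤ 1 / 2 := by
  obtain ⟨K, hK, r, hr, htay⟩ := exists_quadratic_taylor_bound hΦ ν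
  obtain ⟨ρ, hρ, hρS⟩ := Metric.nhds_basis_closedBall.mem_iff.1 hS
  let L : (Fin d → ℝ) →L[ℝ] (Fin d → ℝ) := LinearMap.toContinuousLinearMap (A⁻¹).mulVecLin
  have hL : ∀ y, ‖A⁻¹ *ᵥ y‖ ≤ ‖L‖ * ‖y‖ := fun y => L.le_opNorm y
  set B : ℝ := 2 * Real.pi * (2 * d + k * (K * ‖L‖ ^ 2)) with hB
  have hB0 : 0 ≤ B := by positivity
  refine ⟨min (min 1 (min r ρ / (‖L‖ + 1))) (1 / (2 * (B + 1))),
    by positivity, fun ε hε hε₀ δ hδ hδ1 y hy => ?_⟩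
  have hε1 : ε ≤ 1 := hε₀.trans ((min_le_left _ _).trans (min_le_left _ _))
  have hε2 : ε * (‖L‖ + 1) ≤ min r ρ := by
    have := hε₀.trans ((min_le_left _ _).trans (min_le_right _ _))
    rwa [le_div_iff₀ (by positivity)] at this
  have hε3 : ε * B ≤ 1 / 2 := by
    have := hε₀.trans (min_le_right _ _)
    rw [le_div_iff₀ (by positivity)] at this
    nlinarith
  rw [mem_anisoBox] at hy
  have hyn : ‖y‖ ≤ ε * δ := by
    rw [pi_norm_le_iff_of_nonneg (by positivity)]
    intro m
    refine (hy m).trans ?_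
    gcongr
    exact (pow_le_pow_of_le_one hδ.le hδ1 (he m)).trans (by simp)
  set η := A⁻¹ *ᵥ y with hη
  have hηn : ‖η‖ ≤ ‖L‖ * (ε * δ) := (hL y).trans (by gcongr)
  have hηr : ‖η‖ ≤ min r ρ := by
    refine hηn.trans (le_trans ?_ hε2)
    have : ‖L‖ * (ε * δ) = ε * (‖L‖ * δ) := by ring
    rw [this]
    gcongr
    nlinarith [norm_nonneg L]
  refine ⟨hρS (by simpa [dist_eq_norm] using hηr.trans (min_le_right _ _)), ?_⟩
  intro v w hv hw hvw
  have hAη : A *ᵥ η = y := by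
    rw [hη, Matrix.mulVec_mulVec, Matrix.mul_nonsing_inv _ hA, Matrix.one_mulVec]
  have hlin : ∑ i, (w.1 i + ∑ j, w.2 j * gradPhi d (fun x => Φ x j) ν i) * η i
      = ∑ m, v m * y m := by
    simp_rw [hvw]
    change (v ᵥ* A) ⬝ᵥ η = v ⬝ᵥ y
    rw [← Matrix.dotProduct_mulVec, hAη]
  have hdec : extPhase Φ w (ν + η) - extPhase Φ w ν = ∑ m, v m * y m +
      ∑ j, w.2 j * (Φ (ν + η) j - Φ ν j - ∑ i, gradPhi d (fun x => Φ x j) ν i * η i) := by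
    rw [← hlin]
    simp only [extPhase, mul_sub, Finset.sum_sub_distrib, add_mul, Finset.sum_add_distrib,
      Pi.add_apply, mul_add, Finset.sum_mul, Finset.mul_sum]
    rw [Finset.sum_comm (γ := Fin d)]
    simp only [mul_assoc]
    ring
  have h1 : |∑ m, v m * y m| ≤ d * (2 * ε) := by
    refine (Finset.abs_sum_le_sum_abs _ _).trans ?_
    refine (Finset.sum_le_card_nsmul _ _ (2 * ε) fun m _ => ?_).trans (by simp)
    rw [abs_mul]
    refine (mul_le_mul (hv m) (hy m) (abs_nonneg _) (by positivity)).trans (le_of_eq ?_)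
    rw [inv_pow]
    field_simp
  have h2 : |∑ j, w.2 j * (Φ (ν + η) j - Φ ν j - ∑ i, gradPhi d (fun x => Φ x j) ν i * η i)|
      ≤ k * (K * ‖L‖ ^ 2 * ε) := by
    refine (Finset.abs_sum_le_sum_abs _ _).trans ?_
    refine (Finset.sum_le_card_nsmul _ _ (K * ‖L‖ ^ 2 * ε) fun j _ => ?_).trans (by simp)
    rw [abs_mul]
    calc _ ≤ δ⁻¹ ^ 2 * (K * (‖L‖ * (ε * δ)) ^ 2) := by
          refine mul_le_mul (hw j) ((htay η (hηr.trans (min_le_left _ _)) j).trans ?_)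
            (abs_nonneg _) (by positivity)
          gcongr
      _ = K * ‖L‖ ^ 2 * ε * ε := by field_simp
      _ ≤ K * ‖L‖ ^ 2 * ε * 1 := by gcongr
      _ = _ := mul_one _
  rw [hdec, abs_mul, abs_of_pos Real.two_pi_pos]
  calc _ ≤ 2 * Real.pi * (d * (2 * ε) + k * (K * ‖L‖ ^ 2 * ε)) := by
        gcongr
        exact (abs_add_le _ _).trans (add_le_add h1 h2)
    _ = ε * B := by rw [hB]; ring
    _ ≤ 1 / 2 := hε3

lemma volume_affine_image {d : ℕ} (A : Matrix (Fin d) (Fin d) ℝ) (ν : Fin d → ℝ)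
    (B : Set (Fin d → ℝ)) :
    volume ((fun y => ν + A *ᵥ y) '' B) = ENNReal.ofReal |A.det| * volume B := by
  have h : (fun y => ν + A *ᵥ y) '' B = (fun x => ν + x) '' (Matrix.toLin' A '' B) := by
    rw [Set.image_image]
    rfl
  rw [h, Set.image_add_left, measure_preimage_add, Measure.addHaar_image_linearMap,
    LinearMap.det_toLin']

/-- The region `{(u A - t G, t)}` with `u`, `t` in anisotropic boxes, on which the squashed caps
have no cancellation. -/
def dualRegion {d k : ℕ} (A : Matrix (Fin d) (Fin d) ℝ) (G : Matrix (Fin k) (Fin d) ℝ)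
    (e : Fin d → ℕ) (δ : ℝ) : Set ((Fin d → ℝ) × (Fin k → ℝ)) :=
  (fun z => (z.1 ᵥ* A - z.2 ᵥ* G, z.2)) '' (anisoBox e 1 δ⁻¹ ×ˢ anisoBox (fun _ => 2) 1 δ⁻¹)

lemma isCompact_dualRegion {d k : ℕ} (A : Matrix (Fin d) (Fin d) ℝ) (G : Matrix (Fin k) (Fin d) ℝ)
    (e : Fin d → ℕ) (δ : ℝ) : IsCompact (dualRegion A G e δ) := by
  refine (isCompact_Icc.prod isCompact_Icc).image ?_
  fun_prop

lemma exists_volume_dualRegion {d k : ℕ} {A : Matrix (Fin d) (Fin d) ℝ} (hA : IsUnit A.det)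
    (G : Matrix (Fin k) (Fin d) ℝ) (e : Fin d → ℕ) :
    ∃ b > 0, ∀ δ, 0 < δ →
      volume (dualRegion A G e δ) = ENNReal.ofReal (b * δ⁻¹ ^ (∑ m, e m + 2 * k)) := by
  let T : ((Fin d → ℝ) × (Fin k → ℝ)) →ₗ[ℝ] ((Fin d → ℝ) × (Fin k → ℝ)) :=
    LinearMap.prod (A.vecMulLinear ∘ₗ LinearMap.fst ℝ _ _ - G.vecMulLinear ∘ₗ LinearMap.snd ℝ _ _)
      (LinearMap.snd ℝ _ _)
  have hT : ∀ z, T z = (z.1 ᵥ* A - z.2 ᵥ* G, z.2) := fun _ => rfl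
  have hinj : Function.Injective T := by
    rw [← LinearMap.ker_eq_bot, LinearMap.ker_eq_bot']
    rintro ⟨u, t⟩ h
    rw [hT, Prod.mk_eq_zero] at h
    obtain ⟨h1, rfl⟩ := h
    simp only [Matrix.zero_vecMul, sub_zero] at h1
    have : u = 0 := Matrix.eq_zero_of_vecMul_eq_zero hA.ne_zero h1
    rw [this]
    rfl
  have hdet : LinearMap.det T ≠ 0 :=
    (LinearEquiv.isUnit_det' (LinearEquiv.ofInjectiveEndo T hinj)).ne_zero
  have : (volume : Measure ((Fin d → ℝ) × (Fin k → ℝ))).IsAddHaarMeasure :=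
    Measure.prod.instIsAddHaarMeasure _ _
  refine ⟨|LinearMap.det T| * (2 ^ d * 2 ^ k), by positivity, fun δ hδ => ?_⟩
  have h : dualRegion A G e δ = T '' (anisoBox e 1 δ⁻¹ ×ˢ anisoBox (fun _ => 2) 1 δ⁻¹) := rfl
  rw [h, Measure.addHaar_image_linearMap, Measure.volume_eq_prod, Measure.prod_prod,
    volume_anisoBox _ zero_le_one (by positivity), volume_anisoBox _ zero_le_one (by positivity),
    ← ENNReal.ofReal_mul (by positivity), ← ENNReal.ofReal_mul (by positivity)]
  congr 1
  simp only [mul_one, Finset.sum_const, Finset.card_univ, Fintype.card_fin, smul_eq_mul, pow_add,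
    mul_comm k 2]
  ring

lemma exponent_le_of_scaling {a b C P Q : ℝ} (ha : 0 < a) (hb : 0 < b) (N M : ℕ)
    (h : ∀ δ : ℝ, 0 < δ → δ ≤ 1 → (a * δ ^ N / 2) ^ 2 * (b * δ⁻¹ ^ M) ^ Q ≤
      C * (a * δ ^ N) ^ P * (a * δ ^ N) ^ P) :
    2 * N * P + M * Q ≤ 2 * N := by
  by_contra! hlt
  have hlim := tendsto_rpow_neg_nhdsGT_zero (y := 2 * N - M * Q - 2 * N * P) (by linarith)
  have hbound : ∀ δ : ℝ, 0 < δ → δ ≤ 1 → δ ^ (2 * N - M * Q - 2 * N * P : ℝ) ≤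
      C * a ^ P * a ^ P / ((a / 2) ^ 2 * b ^ Q) := fun δ hδ hδ1 => by
    have h1 : (a * δ ^ N) ^ P = a ^ P * δ ^ (N * P : ℝ) := by
      rw [Real.mul_rpow ha.le (by positivity), Real.rpow_mul hδ.le, Real.rpow_natCast]
    have h2 : (b * δ⁻¹ ^ M) ^ Q = b ^ Q * δ ^ (-(M * Q) : ℝ) := by
      rw [Real.mul_rpow hb.le (by positivity), Real.rpow_neg hδ.le, Real.rpow_mul hδ.le,
        Real.rpow_natCast, inv_pow, Real.inv_rpow (by positivity)]
    have h3 : (a * δ ^ N / 2) ^ 2 = (a / 2) ^ 2 * δ ^ (2 * N : ℝ) := by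
      rw [mul_comm (2 : ℝ), Real.rpow_mul hδ.le, Real.rpow_natCast, Real.rpow_two]
      ring
    have h4 : δ ^ (2 * N - M * Q - 2 * N * P : ℝ) * (δ ^ (N * P : ℝ) * δ ^ (N * P : ℝ)) =
        δ ^ (2 * N : ℝ) * δ ^ (-(M * Q) : ℝ) := by
      simp only [← Real.rpow_add hδ]
      congr 1
      ring
    have h5 := h δ hδ hδ1
    rw [h1, h2, h3] at h5
    rw [le_div_iff₀ (by positivity)]
    have h6 : 0 < δ ^ (N * P : ℝ) * δ ^ (N * P : ℝ) := by positivity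
    refine le_of_mul_le_mul_right ?_ h6
    calc _ = (δ ^ (2 * N - M * Q - 2 * N * P : ℝ) * (δ ^ (N * P : ℝ) * δ ^ (N * P : ℝ))) *
          ((a / 2) ^ 2 * b ^ Q) := by ring
      _ = _ := by rw [h4]
      _ ≤ _ := by convert h5 using 1 <;> ring
  have hev := (hlim.eventually_gt_atTop (C * a ^ P * a ^ P / ((a / 2) ^ 2 * b ^ Q))).and
    (Ioc_mem_nhdsGT (zero_lt_one (α := ℝ)))
  obtain ⟨δ, h1, h2⟩ := hev.exists
  exact absurd (hbound δ h2.1 h2.2) (not_le.2 h1)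

lemma exists_cap_bounds
    {d k : ℕ} {Φ : (Fin d → ℝ) → Fin k → ℝ} (hΦ : ContDiff ℝ (⊤ : ℕ∞) Φ)
    {S₁ S₂ : Set (Fin d → ℝ)} {ν₁ ν₂ : Fin d → ℝ} (hν₁ : S₁ ∈ nhds ν₁) (hν₂ : S₂ ∈ nhds ν₂)
    (hind : LinearIndependent ℝ (fun j : Fin k => Dmat d k Φ ν₁ ν₂ j)) :
    ∃ a > 0, ∃ b > 0, ∀ δ : ℝ, 0 < δ → δ ≤ 1 →
      ∃ (R₁ R₂ : Set (Fin d → ℝ)) (W : Set ((Fin d → ℝ) × (Fin k → ℝ))),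
        IsCompact W ∧
        volume R₁ = ENNReal.ofReal (a * δ ^ (d + k)) ∧
        volume R₂ = ENNReal.ofReal (a * δ ^ (d + k)) ∧
        volume W = ENNReal.ofReal (b * δ⁻¹ ^ (d + 3 * k)) ∧
        ∀ w ∈ W,
          a * δ ^ (d + k) / 2 ≤ ‖extOp d k S₁ Φ (R₁.indicator fun _ => 1) w‖ ∧
          a * δ ^ (d + k) / 2 ≤ ‖extOp d k S₂ Φ (R₂.indicator fun _ => 1) w‖ := by
  classical
  obtain ⟨A, κ, hA, hκ, hAκ⟩ := exists_matrix_extending_rows (Dmat d k Φ ν₁ ν₂) hind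
  let e : Fin d → ℕ := fun m => 1 + if m ∈ Finset.univ.image κ then 1 else 0
  have he : ∀ m, 1 ≤ e m := fun m => Nat.le_add_right _ _
  have heκ : ∀ j, e (κ j) = 2 := fun j => by simp [e]
  have hesum : ∑ m, e m = d + k := by
    simp only [e, Finset.sum_add_distrib, Finset.sum_ite_mem, Finset.univ_inter]
    simp [Finset.card_image_of_injective _ hκ]
  obtain ⟨ε₁, hε₁, H₁⟩ := exists_phase_bound hΦ hA he hν₁
  obtain ⟨ε₂, hε₂, H₂⟩ := exists_phase_bound hΦ hA he hν₂
  let G : Matrix (Fin k) (Fin d) ℝ := Matrix.of fun j => gradPhi d (fun x => Φ x j) ν₁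
  obtain ⟨b, hb, hvolW⟩ := exists_volume_dualRegion hA G e
  set ε := min ε₁ ε₂
  have hε : 0 < ε := lt_min hε₁ hε₂
  have hA' : A⁻¹.det ≠ 0 := (Matrix.isUnit_nonsing_inv_det A hA).ne_zero
  refine ⟨|A⁻¹.det| * (2 * ε) ^ d, by positivity, b, hb, fun δ hδ hδ1 => ?_⟩
  let R : (Fin d → ℝ) → Set (Fin d → ℝ) := fun ν => (fun y => ν + A⁻¹ *ᵥ y) '' anisoBox e ε δ
  have hRvol : ∀ ν, volume (R ν) = ENNReal.ofReal (|A⁻¹.det| * (2 * ε) ^ d * δ ^ (d + k)) := by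
    intro ν
    rw [volume_affine_image, volume_anisoBox _ hε.le hδ.le, hesum,
      ← ENNReal.ofReal_mul (abs_nonneg _), mul_assoc]
  have hRreal : ∀ ν, volume.real (R ν) = |A⁻¹.det| * (2 * ε) ^ d * δ ^ (d + k) := fun ν => by
    rw [measureReal_def, hRvol, ENNReal.toReal_ofReal (by positivity)]
  have hRc : ∀ ν, IsCompact (R ν) := fun ν => isCompact_Icc.image (by fun_prop)
  refine ⟨R ν₁, R ν₂, dualRegion A G e δ, isCompact_dualRegion A G e δ, hRvol _, hRvol _, ?_, ?_⟩
  · rw [hvolW δ hδ, hesum]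
    congr 3
    ring
  rintro _ ⟨⟨u, t⟩, ⟨hu, ht⟩, rfl⟩
  rw [mem_anisoBox] at hu ht
  simp only [one_mul] at hu ht
  have hpow : ∀ m, 0 ≤ δ⁻¹ ^ e m := fun m => by positivity
  constructor
  · rw [← hRreal ν₁]
    refine half_volume_le_norm_extOp hΦ.continuous (hRc _) ?_ ν₁ _ ?_
    · rintro _ ⟨y, hy, rfl⟩
      exact (H₁ ε hε (min_le_left _ _) δ hδ hδ1 y hy).1
    · rintro _ ⟨y, hy, rfl⟩
      refine (H₁ ε hε (min_le_left _ _) δ hδ hδ1 y hy).2 u _ (fun m => ?_) ht fun i => ?_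
      · linarith [hu m, hpow m]
      · simp [G, Matrix.vecMul, dotProduct]
  · rw [← hRreal ν₂]
    refine half_volume_le_norm_extOp hΦ.continuous (hRc _) ?_ ν₂ _ ?_
    · rintro _ ⟨y, hy, rfl⟩
      exact (H₂ ε hε (min_le_right _ _) δ hδ hδ1 y hy).1
    · rintro _ ⟨y, hy, rfl⟩
      let s : Fin d → ℝ := fun m => ∑ j, if κ j = m then t j else 0
      have hsκ : ∀ j, s (κ j) = t j := fun j => by simp [s, hκ.eq_iff]
      have hs : ∀ m, |s m| ≤ δ⁻¹ ^ e m := fun m => by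
        by_cases hm : ∃ j, κ j = m
        · obtain ⟨j, rfl⟩ := hm
          rw [hsκ, heκ]
          exact ht j
        · push Not at hm
          simpa [s, hm] using hpow m
      refine (H₂ ε hε (min_le_right _ _) δ hδ hδ1 y hy).2 (u + s) _ (fun m => ?_) ht fun i => ?_
      · exact (abs_add_le _ _).trans (by linarith [hu m, hs m])
      · have hsA : (s ᵥ* A) i = ∑ j, t j * Dmat d k Φ ν₁ ν₂ j i := by
          simp only [Matrix.vecMul, dotProduct, s, Finset.sum_mul]
          rw [Finset.sum_comm]
          refine Finset.sum_congr rfl fun j _ => ?_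
          simp [ite_mul, hAκ]
        rw [Matrix.add_vecMul, Pi.add_apply, hsA]
        simp only [Pi.sub_apply, G, Matrix.vecMul, dotProduct, Matrix.of_apply, Dmat, mul_sub,
          Finset.sum_sub_distrib]
        ring

/-- **Necessary condition (ii): `1/p + ((d+3k)/(d+k))·(1/(2q)) ≤ 1`.** If the
cubes have nonempty interior, the matrices `D(ν₁,ν₂)` have rank `k` (i.e. their
rows are linearly independent) for all `ν₁ ∈ S₁`, `ν₂ ∈ S₂`, and the bilinear
estimate holds for some exponents `p, q ∈ [1, ∞]`, then
`1/p + ((d+3k)/(d+k))·(1/(2q)) ≤ 1`. -/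
theorem necessary_condition_pq
    (d k : ℕ) (hd : 1 ≤ d) (hk : 1 ≤ k)
    (Φ : (Fin d → ℝ) → Fin k → ℝ) (hΦ : ContDiff ℝ (⊤ : ℕ∞) Φ)
    (S₁ S₂ : Set (Fin d → ℝ))
    (hS₁ : IsClosedCube d S₁) (hS₂ : IsClosedCube d S₂)
    (hS₁i : (interior S₁).Nonempty) (hS₂i : (interior S₂).Nonempty)
    (hS₁I : S₁ ⊆ Set.Icc (-1) 1) (hS₂I : S₂ ⊆ Set.Icc (-1) 1)
    (hind : ∀ ν₁ ∈ S₁, ∀ ν₂ ∈ S₂,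
      LinearIndependent ℝ (fun j : Fin k => Dmat d k Φ ν₁ ν₂ j))
    (p q : ℝ≥0∞) (hp : 1 ≤ p) (hq : 1 ≤ q) (C : ℝ)
    (hbil : ∀ f g : (Fin d → ℝ) → ℂ,
      eLpNorm (fun w => extOp d k S₁ Φ f w * extOp d k S₂ Φ g w) q volume ≤
        ENNReal.ofReal C * eLpNorm f p volume * eLpNorm g p volume) :
    1 / p + ENNReal.ofReal (((d : ℝ) + 3 * k) / ((d : ℝ) + k)) * (1 / (2 * q)) ≤ 1 := by
  rcases eq_or_ne q ⊤ with rfl | hqt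
  · simpa using hp
  obtain ⟨ν₁, hν₁⟩ := hS₁i
  obtain ⟨ν₂, hν₂⟩ := hS₂i
  obtain ⟨a, ha, b, hb, H⟩ := exists_cap_bounds hΦ (mem_interior_iff_mem_nhds.1 hν₁)
    (mem_interior_iff_mem_nhds.1 hν₂) (hind ν₁ (interior_subset hν₁) ν₂ (interior_subset hν₂))
  have hq0 : q ≠ 0 := (zero_lt_one.trans_le hq).ne'
  have hp0 : p ≠ 0 := (zero_lt_one.trans_le hp).ne'
  have key := exponent_le_of_scaling (C := max C 0) (P := 1 / p.toReal) (Q := 1 / q.toReal)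
    ha hb (d + k) (d + 3 * k) fun δ hδ hδ1 => by
      obtain ⟨R₁, R₂, W, hW, hR₁, hR₂, hWvol, hlow⟩ := H δ hδ hδ1
      set V := a * δ ^ (d + k) with hV
      have hV0 : 0 < V := by positivity
      have hP : 0 ≤ 1 / p.toReal := by positivity
      have hQ : 0 ≤ 1 / q.toReal := by positivity
      have hleft : ENNReal.ofReal ((V / 2) ^ 2 * (b * δ⁻¹ ^ (d + 3 * k)) ^ (1 / q.toReal)) ≤
          eLpNorm (fun w => extOp d k S₁ Φ (R₁.indicator fun _ => 1) w *
            extOp d k S₂ Φ (R₂.indicator fun _ => 1) w) q volume := by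
        have h1 := eLpNorm_indicator_const (μ := volume) (c := (V / 2) ^ 2) hW.measurableSet hq0 hqt
        rw [hWvol, Real.enorm_of_nonneg (by positivity),
          ENNReal.ofReal_rpow_of_nonneg (by positivity) hQ,
          ← ENNReal.ofReal_mul (by positivity)] at h1
        rw [← h1]
        refine eLpNorm_mono fun w => ?_
        by_cases hw : w ∈ W
        · rw [Set.indicator_of_mem hw, norm_mul, Real.norm_of_nonneg (by positivity), sq]
          exact mul_le_mul (hlow w hw).1 (hlow w hw).2 (by positivity) (norm_nonneg _)
        · rw [Set.indicator_of_notMem hw, norm_zero]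
          exact norm_nonneg _
      have hcap : ∀ R : Set (Fin d → ℝ), volume R = ENNReal.ofReal V →
          eLpNorm (R.indicator fun _ => (1 : ℂ)) p volume ≤
            ENNReal.ofReal (V ^ (1 / p.toReal)) := fun R hR => by
        refine (eLpNorm_indicator_const_le (1 : ℂ) p).trans (le_of_eq ?_)
        rw [hR, ENNReal.ofReal_rpow_of_nonneg hV0.le hP]
        simp
      have h2 := hleft.trans ((hbil _ _).trans
        (mul_le_mul' (mul_le_mul' (ENNReal.ofReal_le_ofReal (le_max_left C 0)) (hcap R₁ hR₁))
          (hcap R₂ hR₂)))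
      rwa [← ENNReal.ofReal_mul (le_max_right _ _), ← ENNReal.ofReal_mul (by positivity),
        ENNReal.ofReal_le_ofReal_iff (by positivity)] at h2
  have hpr : 1 / p = ENNReal.ofReal (1 / p.toReal) := by
    rw [one_div, one_div, ← ENNReal.toReal_inv,
      ENNReal.ofReal_toReal (ENNReal.inv_ne_top.2 hp0)]
  have hqr : 1 / (2 * q) = ENNReal.ofReal (1 / q.toReal / 2) := by
    have h2q : 2 * q ≠ 0 := mul_ne_zero two_ne_zero hq0
    rw [one_div, ← ENNReal.ofReal_toReal (ENNReal.inv_ne_top.2 h2q), ENNReal.toReal_inv,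
      ENNReal.toReal_mul, ENNReal.toReal_ofNat]
    congr 1
    rw [mul_inv, one_div]
    ring
  rw [hpr, hqr, ← ENNReal.ofReal_mul (by positivity),
    ← ENNReal.ofReal_add (by positivity) (by positivity), ← ENNReal.ofReal_one]
  refine ENNReal.ofReal_le_ofReal ?_
  have hdk : (0 : ℝ) < d + k := by positivity
  push_cast at key
  have hdiv : ((d : ℝ) + 3 * k) / (d + k) * (1 / q.toReal / 2) =
      (d + 3 * k) * (1 / q.toReal) / (2 * (d + k)) := by
    rw [div_mul_div_comm, mul_comm ((d : ℝ) + k)]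
  rw [hdiv, ← le_sub_iff_add_le', div_le_iff₀ (by positivity)]
  linarith

end
end
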